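/- arXiv:1111.4173 — 9 statements merged into one kernel-verified Lean document; each statement's English description precedes it below -/
import Mathlib

section
/- Under the coordinate change t̃ = φ(t), x̃ = ψ(x), p̃_j^b = (∂x^k/∂x̃^j)(∂φ^b/∂t^c) p_k^c on E*, the canonical components N1^(a)_(i)b = χ^a_bc p_i^c and N2^(a)_(i)j = −Γ^k_ij p_k^a, together with their tilded analogues Ñ1^(b)_(j)c = χ̃^b_cd p̃_j^d and Ñ2^(b)_(j)k = −Γ̃^l_jk p̃_l^b, satisfy the nonlinear-connection transformation rules Ñ1^(b)_(j)c · ∂φ^c/∂t^a = N1^(c)_(k)a (∂φ^b/∂t^c)(∂x^k/∂x̃^j) − ∂p̃_j^b/∂t^a and Ñ2^(b)_(j)k · ∂ψ^k/∂x^i = N2^(c)_(k)i (∂φ^b/∂t^c)(∂x^k/∂x̃^j) − ∂p̃_j^b/∂x^i; hence N0 = (χ^a_bc p_i^c, −Γ^k_ij p_k^a) is a nonlinear connection on E*. -/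
noncomputable section

/-- The dual 1-jet space `E* = ℝ^m × ℝ^n × ℝ^(n×m)`, with coordinates
`(t^a, x^i, p_i^a)`. -/
abbrev Es (m n : ℕ) : Type := (Fin m → ℝ) × (Fin n → ℝ) × (Fin n → Fin m → ℝ)

variable {m n : ℕ}

/-- Kronecker delta. -/
def kd {α : Type*} [DecidableEq α] (a b : α) : ℝ := if a = b then 1 else 0

/-- Partial derivative `∂/∂t^a` on `E*`. -/
def pt (a : Fin m) (F : Es m n → ℝ) (u : Es m n) : ℝ :=
  fderiv ℝ F u (Pi.single a 1, 0, 0)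

/-- Partial derivative `∂/∂x^i` on `E*`. -/
def px (i : Fin n) (F : Es m n → ℝ) (u : Es m n) : ℝ :=
  fderiv ℝ F u (0, Pi.single i 1, 0)

/-- Partial derivative `∂/∂p_i^a` on `E*`. -/
def pp (i : Fin n) (a : Fin m) (F : Es m n → ℝ) (u : Es m n) : ℝ :=
  fderiv ℝ F u (0, 0, Pi.single i (Pi.single a 1))

/-- Adapted derivative `δ/δt^a = ∂/∂t^a - N1^(b)_(j)a ∂/∂p_j^b` of the
nonlinear connection `N = (N1, N2)`; `N1 b j a` stands for `N1^(b)_(j)a`. -/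
def dt (N1 : Fin m → Fin n → Fin m → Es m n → ℝ) (a : Fin m) (F : Es m n → ℝ)
    (u : Es m n) : ℝ :=
  pt a F u - ∑ b, ∑ j, N1 b j a u * pp j b F u

/-- Adapted derivative `δ/δx^i = ∂/∂x^i - N2^(b)_(j)i ∂/∂p_j^b` of the
nonlinear connection `N = (N1, N2)`; `N2 b j i` stands for `N2^(b)_(j)i`. -/
def dx (N2 : Fin m → Fin n → Fin n → Es m n → ℝ) (i : Fin n) (F : Es m n → ℝ)
    (u : Es m n) : ℝ :=
  px i F u - ∑ b, ∑ j, N2 b j i u * pp j b F u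

/-- Partial derivative `∂/∂t^c` on the temporal factor `ℝ^m`. -/
def ptm (c : Fin m) (f : (Fin m → ℝ) → ℝ) (t : Fin m → ℝ) : ℝ :=
  fderiv ℝ f t (Pi.single c 1)

/-- Partial derivative `∂/∂x^k` on the spatial factor `ℝ^n`. -/
def pxn (k : Fin n) (f : (Fin n → ℝ) → ℝ) (x : Fin n → ℝ) : ℝ :=
  fderiv ℝ f x (Pi.single k 1)

section Stmt1

variable (φ ψinv : (Fin m → ℝ) → (Fin m → ℝ))

/-- `∂φ^b/∂t^c`, the Jacobian matrix of a map `φ : ℝ^m → ℝ^m`. -/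
def Jac (φ : (Fin m → ℝ) → (Fin m → ℝ)) (b c : Fin m) (t : Fin m → ℝ) : ℝ :=
  fderiv ℝ φ t (Pi.single c 1) b

/-- `∂²φ^d/∂t^b∂t^c`, the second derivative of a map `φ : ℝ^m → ℝ^m`. -/
def Jac2 (φ : (Fin m → ℝ) → (Fin m → ℝ)) (d b c : Fin m) (t : Fin m → ℝ) : ℝ :=
  fderiv ℝ (fun t' => fderiv ℝ φ t' (Pi.single c 1) d) t (Pi.single b 1)

end Stmt1

/-- The transformed polymomenta `p̃_j^b = (∂x^k/∂x̃^j)(∂φ^b/∂t^c) p_k^c`,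
where `∂x^k/∂x̃^j` is the Jacobian of `ψ⁻¹` evaluated at `x̃ = ψ(x)`. -/
def ptil (φ : (Fin m → ℝ) → (Fin m → ℝ)) (ψ ψinv : (Fin n → ℝ) → (Fin n → ℝ))
    (b : Fin m) (j : Fin n) (t : Fin m → ℝ) (x : Fin n → ℝ)
    (p : Fin n → Fin m → ℝ) : ℝ :=
  ∑ k, ∑ c, Jac ψinv k j (ψ x) * Jac φ b c t * p k c

theorem aux_Jac_smooth {n : ℕ} {f : (Fin n → ℝ) → (Fin n → ℝ)} (hf : ContDiff ℝ (⊤ : ℕ∞) f)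
    (b c : Fin n) : ContDiff ℝ (⊤ : ℕ∞) (Jac f b c) := by
  have h1 : ContDiff ℝ (⊤ : ℕ∞) (fderiv ℝ f) := hf.fderiv_right (by simp)
  have h2 : ContDiff ℝ (⊤ : ℕ∞) (fun t => fderiv ℝ f t (Pi.single c 1)) :=
    h1.clm_apply contDiff_const
  exact (contDiff_pi.1 h2) b

theorem aux_Jac2_symm {n : ℕ} {f : (Fin n → ℝ) → (Fin n → ℝ)} (hf : ContDiff ℝ (⊤ : ℕ∞) f)
    (d b c : Fin n) (t : Fin n → ℝ) : Jac2 f d b c t = Jac2 f d c b t := by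
  have h1 : ContDiff ℝ (⊤ : ℕ∞) (fderiv ℝ f) := hf.fderiv_right (by simp)
  have hd : DifferentiableAt ℝ (fderiv ℝ f) t := (h1.differentiable (by simp)) t
  have key : ∀ v w : Fin n → ℝ, fderiv ℝ (fun t' => fderiv ℝ f t' v d) t w
      = fderiv ℝ (fderiv ℝ f) t w v d := by
    intro v w
    have h := (hasFDerivAt_pi'.1 ((hd.hasFDerivAt).clm_apply (hasFDerivAt_const v t))) d
    rw [h.fderiv]
    simp
  unfold Jac2
  rw [key, key]
  have hs : IsSymmSndFDerivAt ℝ f t :=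
    (hf.contDiffAt).isSymmSndFDerivAt (by
      rw [minSmoothness_of_isRCLikeNormedField]; exact WithTop.coe_le_coe.2 (le_top : (2 : ℕ∞) ≤ ⊤))
  rw [hs.eq]

theorem aux_Jac_comp {n : ℕ} {f g : (Fin n → ℝ) → (Fin n → ℝ)} (hf : ContDiff ℝ (⊤ : ℕ∞) f)
    (hg : ContDiff ℝ (⊤ : ℕ∞) g) (h : Function.LeftInverse g f) (x : Fin n → ℝ) :
    (Matrix.of fun r l => Jac g r l (f x)) * (Matrix.of fun l s => Jac f l s x) = 1 := by
  have hgd : DifferentiableAt ℝ g (f x) := (hg.differentiable (by simp)) _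
  have hfd : DifferentiableAt ℝ f x := (hf.differentiable (by simp)) _
  have hc : (fderiv ℝ g (f x)).comp (fderiv ℝ f x) = ContinuousLinearMap.id ℝ _ := by
    rw [← fderiv_comp x hgd hfd]
    have : g ∘ f = id := funext h
    rw [this, fderiv_id]
  ext r s
  have h2 := congrArg (fun L => L (Pi.single s 1) r) hc
  simp only [ContinuousLinearMap.comp_apply, ContinuousLinearMap.id_apply] at h2
  rw [Matrix.mul_apply, Matrix.one_apply]
  simp only [Matrix.of_apply, Jac]
  have h3 : fderiv ℝ f x (Pi.single s 1)
      = ∑ l, (fderiv ℝ f x (Pi.single s 1) l) • (Pi.single l (1:ℝ) : Fin n → ℝ) := by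
    ext k; simp [Finset.sum_apply, Pi.single_apply]
  rw [h3, map_sum, Finset.sum_apply] at h2
  simp only [map_smul, Pi.smul_apply, smul_eq_mul] at h2
  rw [Pi.single_apply] at h2
  rw [← h2]
  exact Finset.sum_congr rfl fun l _ => mul_comm _ _

theorem aux_spatial {n : ℕ} {ψ ψinv : (Fin n → ℝ) → (Fin n → ℝ)}
    (hψ : ContDiff ℝ (⊤ : ℕ∞) ψ) (hψinv : ContDiff ℝ (⊤ : ℕ∞) ψinv)
    (hψli : Function.LeftInverse ψinv ψ)
    (Γ Γt : Fin n → Fin n → Fin n → (Fin n → ℝ) → ℝ)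
    (hΓtr : ∀ (x : Fin n → ℝ) (l j k : Fin n),
      ∑ p, ∑ q, Γt l p q (ψ x) * Jac ψ p j x * Jac ψ q k x =
        (∑ i, Γ i j k x * Jac ψ l i x) - Jac2 ψ l j k x)
    (x : Fin n → ℝ) (r j i : Fin n) :
    ∑ l, Jac ψinv r l (ψ x) * ∑ k, Γt l j k (ψ x) * Jac ψ k i x
      = (∑ k, Γ r k i x * Jac ψinv k j (ψ x))
        + fderiv ℝ (fun x' => Jac ψinv r j (ψ x')) x (Pi.single i 1) := by
  let A : Matrix (Fin n) (Fin n) ℝ := Matrix.of fun r l => Jac ψinv r l (ψ x)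
  let M : Matrix (Fin n) (Fin n) ℝ := Matrix.of fun l s => Jac ψ l s x
  let T : Matrix (Fin n) (Fin n) ℝ := Matrix.of fun l j => ∑ k, Γt l j k (ψ x) * Jac ψ k i x
  let G : Matrix (Fin n) (Fin n) ℝ := Matrix.of fun r k => Γ r k i x
  let J2 : Matrix (Fin n) (Fin n) ℝ := Matrix.of fun l s => Jac2 ψ l s i x
  let DA : Matrix (Fin n) (Fin n) ℝ := Matrix.of fun r j =>
    fderiv ℝ (fun x' => Jac ψinv r j (ψ x')) x (Pi.single i 1)
  have hAM : A * M = 1 := aux_Jac_comp hψ hψinv hψli x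
  have hMA : M * A = 1 := mul_eq_one_comm.1 hAM
  have hT : T * M = M * G - J2 := by
    ext l s
    have h := hΓtr x l s i
    simp only [T, M, G, J2, Matrix.mul_apply, Matrix.sub_apply, Matrix.of_apply]
    rw [Finset.sum_congr rfl fun a _ => mul_comm (Jac ψ l a x) (Γ a s i x), ← h]
    refine Finset.sum_congr rfl fun p _ => ?_
    rw [Finset.sum_mul]
    exact Finset.sum_congr rfl fun q _ => by ring
  have hD : DA * M + A * J2 = 0 := by
    ext r s
    have hAd : ∀ l, DifferentiableAt ℝ (fun x' => Jac ψinv r l (ψ x')) x := fun l =>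
      (((aux_Jac_smooth hψinv r l).comp hψ).differentiable (by simp)) x
    have hMd : ∀ l, DifferentiableAt ℝ (fun x' => Jac ψ l s x') x := fun l =>
      ((aux_Jac_smooth hψ l s).differentiable (by simp)) x
    have hconst : (fun x' => ∑ l, Jac ψinv r l (ψ x') * Jac ψ l s x')
        = fun _ => (1 : Matrix (Fin n) (Fin n) ℝ) r s := by
      funext x'
      have := congrFun (congrFun (aux_Jac_comp hψ hψinv hψli x') r) s
      simpa [Matrix.mul_apply] using this
    have h := HasFDerivAt.fun_sum (u := Finset.univ) fun l _ =>
      (hAd l).hasFDerivAt.mul (hMd l).hasFDerivAt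
    have h' := h.fderiv
    have h0 : fderiv ℝ (fun x' => ∑ l, Jac ψinv r l (ψ x') * Jac ψ l s x') x = 0 := by
      rw [hconst]; simp
    have h2 := congrArg (fun L => L (Pi.single i 1)) (h'.symm.trans h0)
    simp only [ContinuousLinearMap.sum_apply, ContinuousLinearMap.add_apply,
      ContinuousLinearMap.smul_apply, smul_eq_mul, ContinuousLinearMap.zero_apply] at h2
    simp only [DA, M, A, J2, Matrix.mul_apply, Matrix.add_apply, Matrix.of_apply,
      Matrix.zero_apply]
    rw [← h2, ← Finset.sum_add_distrib]
    refine Finset.sum_congr rfl fun l _ => ?_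
    rw [aux_Jac2_symm hψ l s i x]
    simp only [Jac2, Jac]
    ring
  have hfin : A * T = G * A + DA := by
    calc A * T = A * (T * M) * A := by rw [Matrix.mul_assoc, Matrix.mul_assoc, hMA, Matrix.mul_one]
      _ = (A * M) * G * A - (A * J2) * A := by rw [hT]; noncomm_ring
      _ = G * A + DA * (M * A) := by
        rw [eq_neg_of_add_eq_zero_right hD, hAM]; noncomm_ring
      _ = _ := by rw [hMA, Matrix.mul_one]
  have := congrFun (congrFun hfin r) j
  simpa only [Matrix.mul_apply, Matrix.add_apply, Matrix.of_apply, A, T, G, DA] using this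

theorem aux_comm4 {α β : Type*} [Fintype α] [Fintype β] {γ δ : Type*} [Fintype γ] [Fintype δ]
    (F : α → β → γ → δ → ℝ) :
    ∑ a, ∑ b, ∑ c, ∑ d, F a b c d = ∑ c, ∑ d, ∑ a, ∑ b, F a b c d := by
  have h : ∀ a, ∑ b, ∑ c, ∑ d, F a b c d = ∑ c, ∑ d, ∑ b, F a b c d := fun a => by
    rw [Finset.sum_comm]
    exact Finset.sum_congr rfl fun c _ => Finset.sum_comm
  rw [Finset.sum_congr rfl fun a _ => h a, Finset.sum_comm]
  exact Finset.sum_congr rfl fun c _ => Finset.sum_comm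

/-- Under the coordinate change `t̃ = φ(t)`, `x̃ = ψ(x)`,
`p̃_j^b = (∂x^k/∂x̃^j)(∂φ^b/∂t^c) p_k^c` on `E*`, the canonical components
`N1^(a)_(i)b = χ^a_bc p_i^c` and `N2^(a)_(i)j = -Γ^k_ij p_k^a`, together with
their tilded analogues, satisfy the nonlinear-connection transformation rules;
hence `N0` is a nonlinear connection on `E*`. -/
theorem canonical_nonlinear_connection_transformation (m n : ℕ) (hm : 1 ≤ m) (hn : 1 ≤ n)
    (φ φinv : (Fin m → ℝ) → (Fin m → ℝ))
    (ψ ψinv : (Fin n → ℝ) → (Fin n → ℝ))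
    (hφ : ContDiff ℝ (⊤ : ℕ∞) φ) (hφinv : ContDiff ℝ (⊤ : ℕ∞) φinv)
    (hφli : Function.LeftInverse φinv φ) (hφri : Function.RightInverse φinv φ)
    (hψ : ContDiff ℝ (⊤ : ℕ∞) ψ) (hψinv : ContDiff ℝ (⊤ : ℕ∞) ψinv)
    (hψli : Function.LeftInverse ψinv ψ) (hψri : Function.RightInverse ψinv ψ)
    (χ χt : Fin m → Fin m → Fin m → (Fin m → ℝ) → ℝ)
    (Γ Γt : Fin n → Fin n → Fin n → (Fin n → ℝ) → ℝ)
    (hχ : ∀ a b c, ContDiff ℝ (⊤ : ℕ∞) (χ a b c)) (hΓ : ∀ i j k, ContDiff ℝ (⊤ : ℕ∞) (Γ i j k))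
    -- the Christoffel transformation rule for `χ` and `χ̃`
    (hχtr : ∀ (t : Fin m → ℝ) (d b c : Fin m),
      ∑ e, ∑ f, χt d e f (φ t) * Jac φ e b t * Jac φ f c t =
        (∑ a, χ a b c t * Jac φ d a t) - Jac2 φ d b c t)
    -- the Christoffel transformation rule for `Γ` and `Γ̃`
    (hΓtr : ∀ (x : Fin n → ℝ) (l j k : Fin n),
      ∑ p, ∑ q, Γt l p q (ψ x) * Jac ψ p j x * Jac ψ q k x =
        (∑ i, Γ i j k x * Jac ψ l i x) - Jac2 ψ l j k x)
    -- the canonical nonlinear connection `N0` and its tilded analogue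
    (N1 : Fin m → Fin n → Fin m → Es m n → ℝ)
    (N2 : Fin m → Fin n → Fin n → Es m n → ℝ)
    (N1t : Fin m → Fin n → Fin m → Es m n → ℝ)
    (N2t : Fin m → Fin n → Fin n → Es m n → ℝ)
    (hN1 : ∀ a i b (u : Es m n), N1 a i b u = ∑ c, χ a b c u.1 * u.2.2 i c)
    (hN2 : ∀ a i j (u : Es m n), N2 a i j u = -∑ k, Γ k i j u.2.1 * u.2.2 k a)
    (hN1t : ∀ b j c (v : Es m n), N1t b j c v = ∑ d, χt b c d v.1 * v.2.2 j d)
    (hN2t : ∀ b j k (v : Es m n), N2t b j k v = -∑ l, Γt l j k v.2.1 * v.2.2 l b) :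
    ∀ u : Es m n,
      -- the transformed point `ũ = (φ(t), ψ(x), p̃)`
      (letI v : Es m n :=
        (φ u.1, ψ u.2.1, fun j b => ptil φ ψ ψinv b j u.1 u.2.1 u.2.2)
       -- temporal transformation rule
       (∀ (a b : Fin m) (j : Fin n),
          ∑ c, N1t b j c v * Jac φ c a u.1 =
            (∑ c, ∑ k, N1 c k a u * Jac φ b c u.1 * Jac ψinv k j (ψ u.2.1)) -
              fderiv ℝ (fun t' => ptil φ ψ ψinv b j t' u.2.1 u.2.2) u.1
                (Pi.single a 1)) ∧
       -- spatial transformation rule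
       (∀ (b : Fin m) (i j : Fin n),
          ∑ k, N2t b j k v * Jac ψ k i u.2.1 =
            (∑ c, ∑ k, N2 c k i u * Jac φ b c u.1 * Jac ψinv k j (ψ u.2.1)) -
              fderiv ℝ (fun x' => ptil φ ψ ψinv b j u.1 x' u.2.2) u.2.1
                (Pi.single i 1))) := by
  intro u
  obtain ⟨t, x, p⟩ := u
  refine ⟨fun a b j => ?_, fun b i j => ?_⟩
  · have hder : fderiv ℝ (fun t' => ptil φ ψ ψinv b j t' x p) t (Pi.single a 1)
        = ∑ k, ∑ e, Jac ψinv k j (ψ x) * Jac2 φ b a e t * p k e := by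
      have hJ : ∀ e, HasFDerivAt (Jac φ b e) (fderiv ℝ (Jac φ b e) t) t := fun e =>
        (((aux_Jac_smooth hφ b e).differentiable (by simp)) t).hasFDerivAt
      have h : HasFDerivAt (fun t' => ptil φ ψ ψinv b j t' x p) _ t :=
        HasFDerivAt.fun_sum (u := Finset.univ) fun k _ =>
          HasFDerivAt.fun_sum (u := Finset.univ) fun e _ =>
            ((hJ e).const_mul (Jac ψinv k j (ψ x))).mul_const (p k e)
      rw [h.fderiv]
      simp only [ContinuousLinearMap.sum_apply, ContinuousLinearMap.smul_apply, smul_eq_mul]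
      refine Finset.sum_congr rfl fun k _ => Finset.sum_congr rfl fun e _ => ?_
      have : fderiv ℝ (Jac φ b e) t (Pi.single a 1) = Jac2 φ b a e t := rfl
      rw [this]; ring
    show _ = _ - fderiv ℝ (fun t' => ptil φ ψ ψinv b j t' x p) t (Pi.single a 1)
    rw [hder]
    have hJ2 : ∀ e, Jac2 φ b a e t = (∑ f, χ f a e t * Jac φ b f t)
        - ∑ c, ∑ d, χt b c d (φ t) * Jac φ c a t * Jac φ d e t := fun e => by
      rw [hχtr]; ring
    simp only [hN1t, hN1, hJ2, ptil, mul_sub, sub_mul, Finset.mul_sum, Finset.sum_mul,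
      Finset.sum_sub_distrib]
    have e1 : (∑ c, ∑ k, ∑ e, χ c a e t * p k e * Jac φ b c t * Jac ψinv k j (ψ x))
        = ∑ k, ∑ e, ∑ c, Jac ψinv k j (ψ x) * (χ c a e t * Jac φ b c t) * p k e := by
      rw [Finset.sum_comm]
      refine Finset.sum_congr rfl fun k _ => ?_
      rw [Finset.sum_comm]
      exact Finset.sum_congr rfl fun e _ => Finset.sum_congr rfl fun c _ => by ring
    have e2 : (∑ c, ∑ d, ∑ k, ∑ e,
          χt b c d (φ t) * (Jac ψinv k j (ψ x) * Jac φ d e t * p k e) * Jac φ c a t)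
        = ∑ k, ∑ e, ∑ c, ∑ d,
          Jac ψinv k j (ψ x) * (χt b c d (φ t) * Jac φ c a t * Jac φ d e t) * p k e := by
      rw [aux_comm4]
      exact Finset.sum_congr rfl fun k _ => Finset.sum_congr rfl fun e _ =>
        Finset.sum_congr rfl fun c _ => Finset.sum_congr rfl fun d _ => by ring
    rw [e1, e2]; ring
  · have hder : fderiv ℝ (fun x' => ptil φ ψ ψinv b j t x' p) x (Pi.single i 1)
        = ∑ k, ∑ c, fderiv ℝ (fun x' => Jac ψinv k j (ψ x')) x (Pi.single i 1)
            * Jac φ b c t * p k c := by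
      have hJ : ∀ k, HasFDerivAt (fun x' => Jac ψinv k j (ψ x'))
          (fderiv ℝ (fun x' => Jac ψinv k j (ψ x')) x) x := fun k =>
        ((((aux_Jac_smooth hψinv k j).comp hψ).differentiable (by simp)) x).hasFDerivAt
      have h : HasFDerivAt (fun x' => ptil φ ψ ψinv b j t x' p) _ x :=
        HasFDerivAt.fun_sum (u := Finset.univ) fun k _ =>
          HasFDerivAt.fun_sum (u := Finset.univ) fun c _ =>
            ((hJ k).mul_const (Jac φ b c t)).mul_const (p k c)
      rw [h.fderiv]
      simp only [ContinuousLinearMap.sum_apply, ContinuousLinearMap.smul_apply, smul_eq_mul]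
      exact Finset.sum_congr rfl fun k _ => Finset.sum_congr rfl fun e _ => by ring
    show _ = _ - fderiv ℝ (fun x' => ptil φ ψ ψinv b j t x' p) x (Pi.single i 1)
    rw [hder]
    have hD : ∀ r, fderiv ℝ (fun x' => Jac ψinv r j (ψ x')) x (Pi.single i 1)
        = (∑ l, Jac ψinv r l (ψ x) * ∑ k, Γt l j k (ψ x) * Jac ψ k i x)
          - ∑ k, Γ r k i x * Jac ψinv k j (ψ x) := fun r => by
      rw [aux_spatial hψ hψinv hψli Γ Γt hΓtr x r j i]; ring
    simp only [hN2t, hN2, hD, ptil, mul_sub, sub_mul, neg_mul, Finset.mul_sum, Finset.sum_mul,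
      Finset.sum_sub_distrib, Finset.sum_neg_distrib]
    have e1 : (∑ c, ∑ k, ∑ r, Γ r k i x * p r c * Jac φ b c t * Jac ψinv k j (ψ x))
        = ∑ r, ∑ c, ∑ k, Γ r k i x * Jac ψinv k j (ψ x) * Jac φ b c t * p r c := by
      rw [Finset.sum_comm (s := (Finset.univ : Finset (Fin n))) (t := (Finset.univ : Finset (Fin m)))]
      refine Finset.sum_congr rfl fun c _ => ?_
      rw [Finset.sum_comm]
      exact Finset.sum_congr rfl fun k _ => Finset.sum_congr rfl fun r _ => by ring
    have e2 : (∑ k, ∑ l, ∑ r, ∑ c,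
          Γt l j k (ψ x) * (Jac ψinv r l (ψ x) * Jac φ b c t * p r c) * Jac ψ k i x)
        = ∑ r, ∑ c, ∑ l, ∑ k,
          Jac ψinv r l (ψ x) * (Γt l j k (ψ x) * Jac ψ k i x) * Jac φ b c t * p r c := by
      rw [aux_comm4]
      refine Finset.sum_congr rfl fun r _ => Finset.sum_congr rfl fun c _ => ?_
      rw [Finset.sum_comm]
      exact Finset.sum_congr rfl fun l _ => Finset.sum_congr rfl fun k _ => by ring
    rw [e1, e2]; ring
end
end

section
/- Let h_ab(t) be a smooth symmetric invertible matrix field on ℝ^m with inverse h^ab and Christoffel symbols χ^a_bc, so that ∂h_ab/∂t^c = h_fb χ^f_ac + h_af χ^f_bc. If smooth functions A^(f)(i)_(j)(a)c and A^i_jc on E* satisfy, for all indices, h_bf A^(f)(i)_(j)(a)c = h_ab A^i_jc − δ^i_j (∂h_ab/∂t^c − h_ag χ^g_bc), then A^(a)(j)_(i)(b)c = δ^a_b A^j_ic − δ^j_i χ^a_bc. -/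
noncomputable section

variable {m n : ℕ}

/-- If `h_ab(t)` is a smooth symmetric invertible matrix field
with Christoffel symbols `χ^a_bc` (so `∂h_ab/∂t^c = h_fb χ^f_ac + h_af χ^f_bc`),
and smooth functions `A^(f)(i)_(j)(a)c` and `A^i_jc` on `E*` satisfy
`h_bf A^(f)(i)_(j)(a)c = h_ab A^i_jc - δ^i_j (∂h_ab/∂t^c - h_ag χ^g_bc)`,
then `A^(a)(j)_(i)(b)c = δ^a_b A^j_ic - δ^j_i χ^a_bc`. -/
theorem h_normal_temporal_identity (m n : ℕ) (hm : 1 ≤ m) (hn : 1 ≤ n)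
    (h hinv : Fin m → Fin m → (Fin m → ℝ) → ℝ)
    (χ : Fin m → Fin m → Fin m → (Fin m → ℝ) → ℝ)
    (hsmooth : ∀ a b, ContDiff ℝ (⊤ : ℕ∞) (h a b))
    (hsym : ∀ (t : Fin m → ℝ) (a b : Fin m), h a b t = h b a t)
    (hinverse : ∀ (t : Fin m → ℝ) (a b : Fin m), ∑ f, hinv a f t * h f b t = kd a b)
    -- `χ^a_bc` are the Christoffel symbols of `h`:
    (hchristoffel : ∀ (t : Fin m → ℝ) (a b c : Fin m),
      ptm c (h a b) t = ∑ f, h f b t * χ f a c t + ∑ f, h a f t * χ f b c t)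
    -- `A4 f i j a c` stands for `A^(f)(i)_(j)(a)c`, `A i j c` for `A^i_jc`
    (A4 : Fin m → Fin n → Fin n → Fin m → Fin m → Es m n → ℝ)
    (A : Fin n → Fin n → Fin m → Es m n → ℝ)
    (hA4smooth : ∀ f i j a c, ContDiff ℝ (⊤ : ℕ∞) (A4 f i j a c))
    (hAsmooth : ∀ i j c, ContDiff ℝ (⊤ : ℕ∞) (A i j c))
    -- the component form of `D𝕁 = 0` in the temporal direction:
    (hmain : ∀ (u : Es m n) (a b c : Fin m) (i j : Fin n),
      ∑ f, h b f u.1 * A4 f i j a c u =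
        h a b u.1 * A i j c u -
          kd i j * (ptm c (h a b) u.1 - ∑ g, h a g u.1 * χ g b c u.1)) :
    ∀ (u : Es m n) (a b c : Fin m) (i j : Fin n),
      A4 a j i b c u = kd a b * A j i c u - kd j i * χ a b c u.1 := by
  intro u a b c i j
  have key : ∀ d, ∑ f, h d f u.1 *
      (A4 f j i b c u - (kd f b * A j i c u - kd j i * χ f b c u.1)) = 0 := by
    intro d
    have e1 := hmain u b d c j i
    rw [hchristoffel, add_sub_cancel_right] at e1
    have e2 : ∑ f, h d f u.1 * (kd f b * A j i c u) = h b d u.1 * A j i c u := by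
      rw [hsym u.1 b d]
      simp [kd]
    have e3 : ∑ f, h d f u.1 * (kd j i * χ f b c u.1)
        = kd j i * ∑ f, h f d u.1 * χ f b c u.1 := by
      rw [Finset.mul_sum]
      refine Finset.sum_congr rfl fun f _ => ?_
      rw [hsym u.1 d f]
      ring
    simp only [mul_sub, Finset.sum_sub_distrib]
    rw [e1, e2, e3]
    ring
  have inv : ∀ X : Fin m → ℝ, (∀ d, ∑ f, h d f u.1 * X f = 0) → X a = 0 := by
    intro X hX
    have e : ∑ d, hinv a d u.1 * ∑ f, h d f u.1 * X f = X a := by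
      simp only [Finset.mul_sum]
      rw [Finset.sum_comm]
      simp only [← mul_assoc, ← Finset.sum_mul, hinverse]
      simp [kd]
    rw [← e]
    simp [hX]
  have := inv _ key
  linarith
end
end

section
/- For any nonlinear connection N on E*, the Lie bracket of the temporal adapted vector fields satisfies [δ/δt^a, δ/δt^b] = R^(e)_(r)ab ∂/∂p_r^e (as derivations on smooth functions on E*), where R^(e)_(r)ab = δN1^(e)_(r)a/δt^b − δN1^(e)_(r)b/δt^a and δ/δt^c denotes the adapted vector field applied to a function. -/
noncomputable section

variable {m n : ℕ}

/-- The adapted vector field `δ/δt^a` as a map `E* → E*`. -/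
def wvec (N1 : Fin m → Fin n → Fin m → Es m n → ℝ) (a : Fin m) (u : Es m n) : Es m n :=
  (Pi.single a 1, 0, 0) - ∑ b, ∑ j, N1 b j a u •
    ((0, 0, Pi.single j (Pi.single b 1)) : Es m n)

theorem dt_eq_fderiv (N1 : Fin m → Fin n → Fin m → Es m n → ℝ) (a : Fin m)
    (F : Es m n → ℝ) (u : Es m n) : dt N1 a F u = fderiv ℝ F u (wvec N1 a u) := by
  simp only [dt, wvec, pt, pp, map_sub, map_sum, map_smul, smul_eq_mul]

theorem hasFDerivAt_wvec (N1 : Fin m → Fin n → Fin m → Es m n → ℝ)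
    (hN1 : ∀ e r a, ContDiff ℝ (⊤ : ℕ∞) (N1 e r a)) (a : Fin m) (u : Es m n) :
    HasFDerivAt (wvec N1 a) (-∑ b, ∑ j, (fderiv ℝ (N1 b j a) u).smulRight
      ((0, 0, Pi.single j (Pi.single b 1)) : Es m n)) u := by
  unfold wvec
  refine HasFDerivAt.const_sub ?_ ((Pi.single a 1, 0, 0) : Es m n)
  refine HasFDerivAt.fun_sum fun b _ => HasFDerivAt.fun_sum fun j _ => ?_
  exact (((hN1 b j a).differentiable (by simp)) u).hasFDerivAt.smul_const _

theorem two_le_smooth : (1 + 1 : WithTop ℕ∞) ≤ ((⊤ : ℕ∞) : WithTop ℕ∞) := by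
  have h : ((2 : ℕ∞) : WithTop ℕ∞) ≤ ((⊤ : ℕ∞) : WithTop ℕ∞) := WithTop.coe_le_coe.2 le_top
  rw [one_add_one_eq_two]
  exact h

theorem dt_dt (N1 : Fin m → Fin n → Fin m → Es m n → ℝ)
    (hN1 : ∀ e r a, ContDiff ℝ (⊤ : ℕ∞) (N1 e r a))
    (F : Es m n → ℝ) (hF : ContDiff ℝ (⊤ : ℕ∞) F) (a b : Fin m) (u : Es m n) :
    dt N1 a (fun v => dt N1 b F v) u =
      fderiv ℝ (fderiv ℝ F) u (wvec N1 a u) (wvec N1 b u)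
        - ∑ e, ∑ r, dt N1 a (N1 e r b) u * pp r e F u := by
  have hd : HasFDerivAt (fderiv ℝ F) (fderiv ℝ (fderiv ℝ F) u) u :=
    ((hF.fderiv_right (m := 1) two_le_smooth).differentiable (by simp) u).hasFDerivAt
  have h := hd.clm_apply (hasFDerivAt_wvec N1 hN1 b u)
  rw [dt_eq_fderiv]
  simp only [dt_eq_fderiv, pp]
  rw [h.fderiv]
  simp [map_sum, -Prod.smul_mk]
  ring

/-- For any nonlinear connection `N` on `E*`,
`[δ/δt^a, δ/δt^b] = R^(e)_(r)ab ∂/∂p_r^e` as derivations on smooth functions,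
where `R^(e)_(r)ab = δN1^(e)_(r)a/δt^b - δN1^(e)_(r)b/δt^a`. -/
theorem bracket_dt_dt (m n : ℕ) (hm : 1 ≤ m) (hn : 1 ≤ n)
    (N1 : Fin m → Fin n → Fin m → Es m n → ℝ)
    (N2 : Fin m → Fin n → Fin n → Es m n → ℝ)
    (hN1 : ∀ e r a, ContDiff ℝ (⊤ : ℕ∞) (N1 e r a))
    (hN2 : ∀ e r i, ContDiff ℝ (⊤ : ℕ∞) (N2 e r i))
    (F : Es m n → ℝ) (hF : ContDiff ℝ (⊤ : ℕ∞) F) :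
    ∀ (u : Es m n) (a b : Fin m),
      dt N1 a (fun v => dt N1 b F v) u - dt N1 b (fun v => dt N1 a F v) u =
        ∑ e, ∑ r, (dt N1 b (N1 e r a) u - dt N1 a (N1 e r b) u) * pp r e F u := by
  intro u a b
  rw [dt_dt N1 hN1 F hF, dt_dt N1 hN1 F hF]
  have hs : IsSymmSndFDerivAt ℝ F u :=
    hF.contDiffAt.isSymmSndFDerivAt (by simpa [one_add_one_eq_two] using two_le_smooth)
  rw [hs.eq (wvec N1 a u) (wvec N1 b u)]
  simp only [sub_mul, Finset.sum_sub_distrib]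
  ring
end
end

section
/- For any nonlinear connection N on E*, the Lie bracket of the spatial adapted vector fields satisfies [δ/δx^i, δ/δx^j] = R^(e)_(r)ij ∂/∂p_r^e (as derivations on smooth functions on E*), where R^(e)_(r)ij = δN2^(e)_(r)i/δx^j − δN2^(e)_(r)j/δx^i and δ/δx^k denotes the adapted vector field applied to a function. -/
noncomputable section

variable {m n : ℕ}

/-- A linear form on the vertical directions, expanded in coordinates. -/
lemma vert_expand {m n : ℕ} (L : Es m n →L[ℝ] ℝ) (q : Fin n → Fin m → ℝ) :
    L (0, 0, q) = ∑ b, ∑ j, q j b * L (0, 0, Pi.single j (Pi.single b 1)) := by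
  have h : ((0, 0, q) : Es m n) =
      ∑ b, ∑ j, q j b • ((0, 0, Pi.single j (Pi.single b 1)) : Es m n) := by
    refine Prod.ext ?_ (Prod.ext ?_ ?_)
    · simp [Prod.fst_sum]
    · simp [Prod.fst_sum, Prod.snd_sum]
    · funext k c
      simp only [Prod.snd_sum, Prod.smul_mk, Finset.sum_apply, Pi.smul_apply, smul_eq_mul,
        Pi.single_apply]
      simp [ite_apply, Pi.single_apply]
  rw [h]
  simp only [map_sum, map_smul, smul_eq_mul]

/-- The adapted vector field `δ/δx^i`. -/
def Xf {m n : ℕ} (N2 : Fin m → Fin n → Fin n → Es m n → ℝ) (i : Fin n) (u : Es m n) : Es m n :=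
  (0, Pi.single i 1, fun j b => -N2 b j i u)

lemma dx_eq {m n : ℕ} (N2 : Fin m → Fin n → Fin n → Es m n → ℝ) (i : Fin n)
    (F : Es m n → ℝ) (u : Es m n) : dx N2 i F u = fderiv ℝ F u (Xf N2 i u) := by
  have h : Xf N2 i u = ((0, Pi.single i 1, 0) : Es m n) + (0, 0, fun j b => -N2 b j i u) := by
    simp [Xf]
  rw [h, map_add, vert_expand]
  simp [dx, px, pp, sub_eq_add_neg]

lemma hasFDerivAt_Xf {m n : ℕ} (N2 : Fin m → Fin n → Fin n → Es m n → ℝ)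
    (hN2 : ∀ e r i, ContDiff ℝ (⊤ : ℕ∞) (N2 e r i)) (i : Fin n) (u : Es m n) :
    HasFDerivAt (Xf N2 i)
      ((0 : Es m n →L[ℝ] (Fin m → ℝ)).prod ((0 : Es m n →L[ℝ] (Fin n → ℝ)).prod
        (ContinuousLinearMap.pi fun j => ContinuousLinearMap.pi fun b =>
          -fderiv ℝ (N2 b j i) u))) u := by
  refine (hasFDerivAt_const _ _).prodMk ((hasFDerivAt_const _ _).prodMk ?_)
  refine hasFDerivAt_pi.2 fun j => hasFDerivAt_pi.2 fun b => ?_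
  exact ((hN2 b j i).differentiable (by simp) u).hasFDerivAt.neg

lemma dx_dx {m n : ℕ} (N2 : Fin m → Fin n → Fin n → Es m n → ℝ)
    (hN2 : ∀ e r i, ContDiff ℝ (⊤ : ℕ∞) (N2 e r i))
    (F : Es m n → ℝ) (hF : ContDiff ℝ (⊤ : ℕ∞) F) (u : Es m n) (i j : Fin n) :
    dx N2 i (fun v => dx N2 j F v) u =
      fderiv ℝ (fderiv ℝ F) u (Xf N2 i u) (Xf N2 j u)
        - ∑ e, ∑ r, dx N2 i (N2 e r j) u * pp r e F u := by
  have hd : DifferentiableAt ℝ (fderiv ℝ F) u :=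
    (hF.fderiv_right (m := 1) (WithTop.coe_le_coe.2 (le_top : (1 + 1 : ℕ∞) ≤ ⊤))).differentiable (by simp) u
  have h := hd.hasFDerivAt.clm_apply (hasFDerivAt_Xf N2 hN2 j u)
  have e : (fun v => dx N2 j F v) = fun v => fderiv ℝ F v (Xf N2 j v) :=
    funext fun v => dx_eq N2 j F v
  rw [dx_eq, e, h.fderiv]
  have h2 := vert_expand (fderiv ℝ F u) (fun r e => -fderiv ℝ (N2 e r j) u (Xf N2 i u))
  simp only [dx_eq, pp]
  simp only [neg_mul, Finset.sum_neg_distrib] at h2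
  rw [sub_eq_add_neg, ← h2, add_comm]
  rfl

/-- For any nonlinear connection `N` on `E*`,
`[δ/δx^i, δ/δx^j] = R^(e)_(r)ij ∂/∂p_r^e` as derivations on smooth functions,
where `R^(e)_(r)ij = δN2^(e)_(r)i/δx^j - δN2^(e)_(r)j/δx^i`. -/
theorem bracket_dx_dx (m n : ℕ) (hm : 1 ≤ m) (hn : 1 ≤ n)
    (N1 : Fin m → Fin n → Fin m → Es m n → ℝ)
    (N2 : Fin m → Fin n → Fin n → Es m n → ℝ)
    (hN1 : ∀ e r a, ContDiff ℝ (⊤ : ℕ∞) (N1 e r a))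
    (hN2 : ∀ e r i, ContDiff ℝ (⊤ : ℕ∞) (N2 e r i))
    (F : Es m n → ℝ) (hF : ContDiff ℝ (⊤ : ℕ∞) F) :
    ∀ (u : Es m n) (i j : Fin n),
      dx N2 i (fun v => dx N2 j F v) u - dx N2 j (fun v => dx N2 i F v) u =
        ∑ e, ∑ r, (dx N2 j (N2 e r i) u - dx N2 i (N2 e r j) u) * pp r e F u := by
  intro u i j
  rw [dx_dx N2 hN2 F hF, dx_dx N2 hN2 F hF]
  have hs : IsSymmSndFDerivAt ℝ F u :=
    hF.contDiffAt.isSymmSndFDerivAt (by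
      rw [minSmoothness_of_isRCLikeNormedField]
      exact WithTop.coe_le_coe.2 (le_top : (2 : ℕ∞) ≤ ⊤))
  rw [hs.eq (Xf N2 i u) (Xf N2 j u)]
  simp only [sub_mul, Finset.sum_sub_distrib]
  ring
end
end

section
/- For any nonlinear connection N on E*, the mixed Lie bracket of adapted vector fields satisfies [δ/δt^a, δ/δx^j] = R^(e)_(r)aj ∂/∂p_r^e (as derivations on smooth functions on E*), where R^(e)_(r)aj = δN1^(e)_(r)a/δx^j − δN2^(e)_(r)j/δt^a and δ/δt^b, δ/δx^k denote the adapted vector fields applied to a function. -/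
noncomputable section

variable {m n : ℕ}

/-- The vector field `c - f^(b)_(j) ∂/∂p_j^b`. -/
def vf (c : Es m n) (f : Fin m → Fin n → Es m n → ℝ) (u : Es m n) : Es m n :=
  c - ∑ b, ∑ j, f b j u • ((0, 0, Pi.single j (Pi.single b 1)) : Es m n)

lemma fderiv_vf (c : Es m n) (f : Fin m → Fin n → Es m n → ℝ) (F : Es m n → ℝ) (u : Es m n) :
    fderiv ℝ F u (vf c f u) = fderiv ℝ F u c - ∑ b, ∑ j, f b j u * pp j b F u := by
  simp only [vf, map_sub, map_sum, map_smul, smul_eq_mul, pp]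

lemma hasFDerivAt_vf (c : Es m n) (f : Fin m → Fin n → Es m n → ℝ) (u : Es m n)
    (hf : ∀ b j, DifferentiableAt ℝ (f b j) u) :
    HasFDerivAt (vf c f) (-∑ b, ∑ j, (fderiv ℝ (f b j) u).smulRight
      ((0, 0, Pi.single j (Pi.single b 1)) : Es m n)) u := by
  unfold vf
  refine HasFDerivAt.const_sub ?_ c
  refine HasFDerivAt.fun_sum fun b _ => HasFDerivAt.fun_sum fun j _ => ?_
  exact (hf b j).hasFDerivAt.smul_const _

/-- For any nonlinear connection `N` on `E*`,
`[δ/δt^a, δ/δx^j] = R^(e)_(r)aj ∂/∂p_r^e` as derivations on smooth functions,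
where `R^(e)_(r)aj = δN1^(e)_(r)a/δx^j - δN2^(e)_(r)j/δt^a`. -/
theorem bracket_dt_dx (m n : ℕ) (hm : 1 ≤ m) (hn : 1 ≤ n)
    (N1 : Fin m → Fin n → Fin m → Es m n → ℝ)
    (N2 : Fin m → Fin n → Fin n → Es m n → ℝ)
    (hN1 : ∀ e r a, ContDiff ℝ (⊤ : ℕ∞) (N1 e r a))
    (hN2 : ∀ e r i, ContDiff ℝ (⊤ : ℕ∞) (N2 e r i))
    (F : Es m n → ℝ) (hF : ContDiff ℝ (⊤ : ℕ∞) F) :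
    ∀ (u : Es m n) (a : Fin m) (j : Fin n),
      dt N1 a (fun v => dx N2 j F v) u - dx N2 j (fun v => dt N1 a F v) u =
        ∑ e, ∑ r, (dx N2 j (N1 e r a) u - dt N1 a (N2 e r j) u) * pp r e F u := by
  intro u a j
  have h1 : ∀ b r, DifferentiableAt ℝ (N1 b r a) u := fun b r =>
    (hN1 b r a).differentiable (by simp) u
  have h2 : ∀ b r, DifferentiableAt ℝ (N2 b r j) u := fun b r =>
    (hN2 b r j).differentiable (by simp) u
  have hX := hasFDerivAt_vf (Pi.single a 1, 0, 0) (fun b r => N1 b r a) u h1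
  have hY := hasFDerivAt_vf (0, Pi.single j 1, 0) (fun b r => N2 b r j) u h2
  have et : ∀ (G : Es m n → ℝ) v,
      dt N1 a G v = fderiv ℝ G v (vf (Pi.single a 1, 0, 0) (fun b r => N1 b r a) v) :=
    fun G v => (fderiv_vf _ _ _ _).symm
  have ex : ∀ (G : Es m n → ℝ) v,
      dx N2 j G v = fderiv ℝ G v (vf (0, Pi.single j 1, 0) (fun b r => N2 b r j) v) :=
    fun G v => (fderiv_vf _ _ _ _).symm
  have key := VectorField.fderiv_apply_lieBracket (𝕜 := ℝ) (hF.contDiffAt (x := u))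
    (by simp only [minSmoothness_of_isRCLikeNormedField]; exact WithTop.coe_le_coe.2 (le_top : (2 : ℕ∞) ≤ ⊤))
    hY.differentiableAt hX.differentiableAt
  simp only [et, ex]
  rw [← key, VectorField.lieBracket, hX.fderiv, hY.fderiv]
  simp only [neg_apply, sum_apply,
    ContinuousLinearMap.smulRight_apply, map_sub, map_neg, map_sum, map_smul, smul_eq_mul,
    sub_mul, Finset.sum_sub_distrib, pp]
  ring
end
end

section
/- For the Berwald connection BΓ(N0) = (χ^a_bc, 0, Γ^i_jk, 0) attached to the canonical nonlinear connection N0 with N1^(a)_(i)b = χ^a_bc p_i^c and N2^(a)_(i)j = −Γ^k_ij p_k^a, all torsion d-tensors vanish except the two components R^(f)_(r)ab = χ^f_gab p_r^g and R^(f)_(r)ij = −𝓡^s_rij p_s^f; in particular R^(f)_(r)aj = 0, P^(f)(j)_(r)a(b) := ∂N1^(f)_(r)a/∂p_j^b − δ^j_r χ^f_ba = 0 and P^(f)(j)_(r)i(b) := ∂N2^(f)_(r)i/∂p_j^b + δ^f_b Γ^j_ri = 0. Here χ^f_gab = ∂χ^f_ga/∂t^b − ∂χ^f_gb/∂t^a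 + χ^e_ga χ^f_eb − χ^e_gb χ^f_ea and 𝓡^s_rij = ∂Γ^s_ri/∂x^j − ∂Γ^s_rj/∂x^i + Γ^g_ri Γ^s_gj − Γ^g_rj Γ^s_gi are the curvature tensors of χ and Γ. -/
noncomputable section

variable {m n : ℕ}

/-! ### Christoffel symbols and their curvatures -/

/-- The Christoffel symbols of a (semi-Riemannian) metric `g` with inverse `ginv`
on `ℝ^k`: `γ^a_bc = (1/2) g^{ad} (∂g_db/∂t^c + ∂g_dc/∂t^b - ∂g_bc/∂t^d)`. -/
def christoffel {k : ℕ} (g ginv : Fin k → Fin k → (Fin k → ℝ) → ℝ)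
    (a b c : Fin k) (t : Fin k → ℝ) : ℝ :=
  (1 / 2) * ∑ d, ginv a d t *
    (ptm c (g d b) t + ptm b (g d c) t - ptm d (g b c) t)

/-- The curvature tensor of a family of Christoffel symbols `γ` on `ℝ^k`:
`γ^l_iab = ∂γ^l_ia/∂t^b - ∂γ^l_ib/∂t^a + γ^e_ia γ^l_eb - γ^e_ib γ^l_ea`. -/
def christoffelCurv {k : ℕ} (γ : Fin k → Fin k → Fin k → (Fin k → ℝ) → ℝ)
    (l i a b : Fin k) (t : Fin k → ℝ) : ℝ :=
  ptm b (γ l i a) t - ptm a (γ l i b) t +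
    ∑ e, (γ e i a t * γ l e b t - γ e i b t * γ l e a t)

/-! ### Torsion and curvature d-tensors of an h-normal N-linear connection
`(χ^a_bc, A^i_jc, H^i_jk, C^i(k)_j(c))` on `E*`.  Throughout, `A i j c` stands
for `A^i_jc`, `H i j k` for `H^i_jk` and `C i k j c` for `C^i(k)_j(c)`. -/

section Connection

variable (N1 : Fin m → Fin n → Fin m → Es m n → ℝ)
variable (N2 : Fin m → Fin n → Fin n → Es m n → ℝ)
variable (χ : Fin m → Fin m → Fin m → (Fin m → ℝ) → ℝ)
variable (A : Fin n → Fin n → Fin m → Es m n → ℝ)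
variable (H : Fin n → Fin n → Fin n → Es m n → ℝ)
variable (C : Fin n → Fin n → Fin n → Fin m → Es m n → ℝ)

/-- Torsion `R^(f)_(r)ab = δN1^(f)_(r)a/δt^b - δN1^(f)_(r)b/δt^a`. -/
def RR1 (f : Fin m) (r : Fin n) (a b : Fin m) (u : Es m n) : ℝ :=
  dt N1 b (N1 f r a) u - dt N1 a (N1 f r b) u

/-- Torsion `R^(f)_(r)aj = δN1^(f)_(r)a/δx^j - δN2^(f)_(r)j/δt^a`. -/
def RRmix (f : Fin m) (r : Fin n) (a : Fin m) (j : Fin n) (u : Es m n) : ℝ :=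
  dx N2 j (N1 f r a) u - dt N1 a (N2 f r j) u

/-- Torsion `R^(f)_(r)ij = δN2^(f)_(r)i/δx^j - δN2^(f)_(r)j/δx^i`. -/
def RR2 (f : Fin m) (r i j : Fin n) (u : Es m n) : ℝ :=
  dx N2 j (N2 f r i) u - dx N2 i (N2 f r j) u

/-- Torsion `P^(f)(j)_(r)a(b) = ∂N1^(f)_(r)a/∂p_j^b + δ^f_b A^j_ra - δ^j_r χ^f_ba`. -/
def Ptor1 (f : Fin m) (j : Fin n) (r : Fin n) (a b : Fin m) (u : Es m n) : ℝ :=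
  pp j b (N1 f r a) u + kd f b * A j r a u - kd j r * χ f b a u.1

/-- Torsion `P^(f)(j)_(r)i(b) = ∂N2^(f)_(r)i/∂p_j^b + δ^f_b H^j_ri`. -/
def Ptor2 (f : Fin m) (j r i : Fin n) (b : Fin m) (u : Es m n) : ℝ :=
  pp j b (N2 f r i) u + kd f b * H j r i u

/-- Torsion `S^(f)(j)(k)_(r)(b)(c) = -(δ^f_b C^j(k)_r(c) - δ^f_c C^k(j)_r(b))`. -/
def Stor (f : Fin m) (j k r : Fin n) (b c : Fin m) (u : Es m n) : ℝ :=
  -(kd f b * C j k r c u - kd f c * C k j r b u)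

/-- The `T`-horizontal covariant derivative `C^l(k)_i(c)/b` of `C`. -/
def CcovT (l k i : Fin n) (c : Fin m) (b : Fin m) (u : Es m n) : ℝ :=
  dt N1 b (C l k i c) u + ∑ s, C s k i c u * A l s b u -
    ∑ s, C l k s c u * A s i b u + ∑ s, C l s i c u * A k s b u -
    ∑ f, C l k i f u * χ f c b u.1

/-- The `M`-horizontal covariant derivative
`C^l(k)_i(c)|j = δC^l(k)_i(c)/δx^j + C^s(k)_i(c) H^l_sj - C^l(k)_s(c) H^s_ij
+ C^l(s)_i(c) H^k_sj` of `C`. -/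
def CcovX (l k i : Fin n) (c : Fin m) (j : Fin n) (u : Es m n) : ℝ :=
  dx N2 j (C l k i c) u + ∑ s, C s k i c u * H l s j u -
    ∑ s, C l k s c u * H s i j u + ∑ s, C l s i c u * H k s j u

/-- Curvature `R^l_ibc = δA^l_ib/δt^c - δA^l_ic/δt^b + A^r_ib A^l_rc
- A^r_ic A^l_rb + C^l(r)_i(f) R^(f)_(r)bc`. -/
def curvT (l i : Fin n) (b c : Fin m) (u : Es m n) : ℝ :=
  dt N1 c (A l i b) u - dt N1 b (A l i c) u +
    ∑ r, (A r i b u * A l r c u - A r i c u * A l r b u) +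
    ∑ r, ∑ f, C l r i f u * RR1 N1 f r b c u

/-- Curvature `R^l_ibk = δA^l_ib/δx^k - δH^l_ik/δt^b + A^r_ib H^l_rk
- H^r_ik A^l_rb + C^l(r)_i(f) R^(f)_(r)bk`. -/
def curvMix (l i : Fin n) (b : Fin m) (k : Fin n) (u : Es m n) : ℝ :=
  dx N2 k (A l i b) u - dt N1 b (H l i k) u +
    ∑ r, (A r i b u * H l r k u - H r i k u * A l r b u) +
    ∑ r, ∑ f, C l r i f u * RRmix N1 N2 f r b k u

/-- Curvature `R^l_ijk = δH^l_ij/δx^k - δH^l_ik/δx^j + H^r_ij H^l_rk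
- H^r_ik H^l_rj + C^l(r)_i(f) R^(f)_(r)jk`. -/
def curvH (l i j k : Fin n) (u : Es m n) : ℝ :=
  dx N2 k (H l i j) u - dx N2 j (H l i k) u +
    ∑ r, (H r i j u * H l r k u - H r i k u * H l r j u) +
    ∑ r, ∑ f, C l r i f u * RR2 N2 f r j k u

/-- Curvature `P^l(k)_ib(c) = ∂A^l_ib/∂p_k^c - C^l(k)_i(c)/b
+ C^l(r)_i(f) P^(f)(k)_(r)b(c)`. -/
def curvP1 (l i : Fin n) (b : Fin m) (k : Fin n) (c : Fin m) (u : Es m n) : ℝ :=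
  pp k c (A l i b) u - CcovT N1 χ A C l k i c b u +
    ∑ r, ∑ f, C l r i f u * Ptor1 N1 χ A f k r b c u

/-- Curvature `P^l(k)_ij(c) = ∂H^l_ij/∂p_k^c - C^l(k)_i(c)|j
+ C^l(r)_i(f) P^(f)(k)_(r)j(c)`. -/
def curvP2 (l i j k : Fin n) (c : Fin m) (u : Es m n) : ℝ :=
  pp k c (H l i j) u - CcovX N2 H C l k i c j u +
    ∑ r, ∑ f, C l r i f u * Ptor2 N2 H f k r j c u

/-- Curvature `S^l(j)(k)_i(b)(c) = ∂C^l(j)_i(b)/∂p_k^c - ∂C^l(k)_i(c)/∂p_j^b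
+ C^r(j)_i(b) C^l(k)_r(c) - C^r(k)_i(c) C^l(j)_r(b)`. -/
def curvS (l j k i : Fin n) (b c : Fin m) (u : Es m n) : ℝ :=
  pp k c (C l j i b) u - pp j b (C l k i c) u +
    ∑ r, (C r j i b u * C l k r c u - C r k i c u * C l j r b u)

end Connection


theorem christoffel_sym {k : ℕ} (g ginv : Fin k → Fin k → (Fin k → ℝ) → ℝ)
    (hsym : ∀ t a b, g a b t = g b a t) (a b c : Fin k) (t : Fin k → ℝ) :
    christoffel g ginv a b c t = christoffel g ginv a c b t := by
  have h1 : g b c = g c b := funext fun t => hsym t b c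
  unfold christoffel
  rw [h1]
  congr 1
  refine Finset.sum_congr rfl fun d _ => ?_
  ring

theorem christoffel_diff {k : ℕ} (g ginv : Fin k → Fin k → (Fin k → ℝ) → ℝ)
    (hg : ∀ a b, ContDiff ℝ (⊤ : ℕ∞) (g a b))
    (hginv : ∀ a b, ContDiff ℝ (⊤ : ℕ∞) (ginv a b)) (a b c : Fin k) :
    Differentiable ℝ (christoffel g ginv a b c) := by
  have h1 : ∀ a b c, Differentiable ℝ (fun t => ptm c (g a b) t) := by
    intro a b c
    have h2 : Differentiable ℝ (fderiv ℝ (g a b)) :=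
      ((hg a b).fderiv_right (m := 1) (by norm_cast)).differentiable (by norm_num)
    unfold ptm
    fun_prop
  have h3 : ∀ a b, Differentiable ℝ (ginv a b) := fun a b =>
    (hginv a b).differentiable (by simp)
  unfold christoffel
  fun_prop

theorem fderiv_N1 {m n : ℕ} (F : Fin m → (Fin m → ℝ) → ℝ) (hF : ∀ c, Differentiable ℝ (F c))
    (r : Fin n) (u v : Es m n) :
    fderiv ℝ (fun u : Es m n => ∑ c, F c u.1 * u.2.2 r c) u v =
      ∑ c, (fderiv ℝ (F c) u.1 v.1 * u.2.2 r c + F c u.1 * v.2.2 r c) := by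
  have hp : ∀ c, HasFDerivAt (fun u : Es m n => u.2.2 r c)
      ((ContinuousLinearMap.proj c).comp ((ContinuousLinearMap.proj (φ := fun _ : Fin n => Fin m → ℝ) r).comp
        ((ContinuousLinearMap.snd ℝ (Fin n → ℝ) (Fin n → Fin m → ℝ)).comp
          (ContinuousLinearMap.snd ℝ (Fin m → ℝ) _))) : Es m n →L[ℝ] ℝ) u := fun c =>
    ContinuousLinearMap.hasFDerivAt ((ContinuousLinearMap.proj c).comp ((ContinuousLinearMap.proj (φ := fun _ : Fin n => Fin m → ℝ) r).comp
        ((ContinuousLinearMap.snd ℝ (Fin n → ℝ) (Fin n → Fin m → ℝ)).comp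
          (ContinuousLinearMap.snd ℝ (Fin m → ℝ) _))) : Es m n →L[ℝ] ℝ)
  have hq : ∀ c, HasFDerivAt (fun u : Es m n => F c u.1)
      ((fderiv ℝ (F c) u.1).comp (ContinuousLinearMap.fst ℝ _ _)) u := fun c =>
    ((hF c) u.1).hasFDerivAt.comp u hasFDerivAt_fst
  have := HasFDerivAt.fun_sum (u := Finset.univ) fun c _ => (hq c).fun_mul (hp c)
  rw [this.fderiv]
  simp
  refine Finset.sum_congr rfl fun c _ => ?_
  ring

theorem fderiv_N2 {m n : ℕ} (F : Fin n → (Fin n → ℝ) → ℝ) (hF : ∀ c, Differentiable ℝ (F c))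
    (f : Fin m) (u v : Es m n) :
    fderiv ℝ (fun u : Es m n => -∑ k, F k u.2.1 * u.2.2 k f) u v =
      -∑ k, (fderiv ℝ (F k) u.2.1 v.2.1 * u.2.2 k f + F k u.2.1 * v.2.2 k f) := by
  have hp : ∀ k, HasFDerivAt (fun u : Es m n => u.2.2 k f)
      ((ContinuousLinearMap.proj f).comp ((ContinuousLinearMap.proj (φ := fun _ : Fin n => Fin m → ℝ) k).comp
        ((ContinuousLinearMap.snd ℝ (Fin n → ℝ) (Fin n → Fin m → ℝ)).comp
          (ContinuousLinearMap.snd ℝ (Fin m → ℝ) _))) : Es m n →L[ℝ] ℝ) u := fun k =>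
    ContinuousLinearMap.hasFDerivAt ((ContinuousLinearMap.proj f).comp ((ContinuousLinearMap.proj (φ := fun _ : Fin n => Fin m → ℝ) k).comp
        ((ContinuousLinearMap.snd ℝ (Fin n → ℝ) (Fin n → Fin m → ℝ)).comp
          (ContinuousLinearMap.snd ℝ (Fin m → ℝ) _))) : Es m n →L[ℝ] ℝ)
  have hq : ∀ k, HasFDerivAt (fun u : Es m n => F k u.2.1)
      ((fderiv ℝ (F k) u.2.1).comp ((ContinuousLinearMap.fst ℝ (Fin n → ℝ) (Fin n → Fin m → ℝ)).comp
          (ContinuousLinearMap.snd ℝ (Fin m → ℝ) _))) u := fun k =>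
    HasFDerivAt.comp u ((hF k) u.2.1).hasFDerivAt
      (ContinuousLinearMap.hasFDerivAt ((ContinuousLinearMap.fst ℝ (Fin n → ℝ) (Fin n → Fin m → ℝ)).comp
          (ContinuousLinearMap.snd ℝ (Fin m → ℝ) _)))
  have := (HasFDerivAt.fun_sum (u := Finset.univ) fun c _ => (hq c).fun_mul (hp c)).fun_neg
  rw [this.fderiv]
  simp
  refine Finset.sum_congr rfl fun c _ => ?_
  ring

/-- For the Berwald connection `BΓ(N0) = (χ^a_bc, 0, Γ^i_jk, 0)`
attached to the canonical nonlinear connection `N0`, all torsion d-tensors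
vanish except `R^(f)_(r)ab = χ^f_gab p_r^g` and `R^(f)_(r)ij = -𝓡^s_rij p_s^f`. -/
theorem berwald_torsion (m n : ℕ) (hm : 1 ≤ m) (hn : 1 ≤ n)
    -- the temporal metric `h` and its inverse
    (h hinv : Fin m → Fin m → (Fin m → ℝ) → ℝ)
    (hsmooth : ∀ a b, ContDiff ℝ (⊤ : ℕ∞) (h a b)) (hinvsmooth : ∀ a b, ContDiff ℝ (⊤ : ℕ∞) (hinv a b))
    (hsym : ∀ t a b, h a b t = h b a t)
    (hinverse : ∀ t a b, ∑ f, hinv a f t * h f b t = kd a b)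
    -- the spatial metric `φ` and its inverse
    (φg φginv : Fin n → Fin n → (Fin n → ℝ) → ℝ)
    (φsmooth : ∀ i j, ContDiff ℝ (⊤ : ℕ∞) (φg i j)) (φinvsmooth : ∀ i j, ContDiff ℝ (⊤ : ℕ∞) (φginv i j))
    (φsym : ∀ x i j, φg i j x = φg j i x)
    (φinverse : ∀ x i j, ∑ k, φginv i k x * φg k j x = kd i j)
    -- their Christoffel symbols
    (χ : Fin m → Fin m → Fin m → (Fin m → ℝ) → ℝ)
    (Γ : Fin n → Fin n → Fin n → (Fin n → ℝ) → ℝ)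
    (hχ : ∀ a b c t, χ a b c t = christoffel h hinv a b c t)
    (hΓ : ∀ i j k x, Γ i j k x = christoffel φg φginv i j k x)
    -- the canonical nonlinear connection `N0`
    (N1 : Fin m → Fin n → Fin m → Es m n → ℝ)
    (N2 : Fin m → Fin n → Fin n → Es m n → ℝ)
    (hN1 : ∀ a i b (u : Es m n), N1 a i b u = ∑ c, χ a b c u.1 * u.2.2 i c)
    (hN2 : ∀ a i j (u : Es m n), N2 a i j u = -∑ k, Γ k i j u.2.1 * u.2.2 k a) :
    ∀ (u : Es m n) (f a b : Fin m) (r i j : Fin n) (c : Fin m) (k : Fin n),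
      -- `R^(f)_(r)ab = χ^f_gab p_r^g`
      RR1 N1 f r a b u = ∑ g, christoffelCurv χ f g a b u.1 * u.2.2 r g ∧
      -- `R^(f)_(r)aj = 0`
      RRmix N1 N2 f r a j u = 0 ∧
      -- `R^(f)_(r)ij = -𝓡^s_rij p_s^f`
      RR2 N2 f r i j u = -∑ s, christoffelCurv Γ s r i j u.2.1 * u.2.2 s f ∧
      -- `P^(f)(j)_(r)a(b) = ∂N1^(f)_(r)a/∂p_j^b - δ^j_r χ^f_ba = 0` (here `A = 0`)
      Ptor1 N1 χ (fun _ _ _ _ => 0) f j r a b u = 0 ∧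
      -- `P^(f)(j)_(r)i(b) = ∂N2^(f)_(r)i/∂p_j^b + δ^f_b Γ^j_ri = 0` (here `H^j_ri = Γ^j_ri`)
      Ptor2 N2 (fun j' r' i' (v : Es m n) => Γ j' r' i' v.2.1) f j r i b u = 0 := by
  have eχ : ∀ a b c, χ a b c = christoffel h hinv a b c := fun a b c => funext (hχ a b c)
  have eΓ : ∀ a b c, Γ a b c = christoffel φg φginv a b c := fun a b c => funext (hΓ a b c)
  have dχ : ∀ a b c, Differentiable ℝ (χ a b c) := fun a b c => by
    rw [eχ]; exact christoffel_diff h hinv hsmooth hinvsmooth a b c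
  have dΓ : ∀ a b c, Differentiable ℝ (Γ a b c) := fun a b c => by
    rw [eΓ]; exact christoffel_diff φg φginv φsmooth φinvsmooth a b c
  have sχ : ∀ a b c, χ a b c = χ a c b := fun a b c => funext fun t => by
    rw [eχ, eχ]; exact christoffel_sym h hinv hsym a b c t
  have eN1 : ∀ a i b, N1 a i b = fun u : Es m n => ∑ c, χ a b c u.1 * u.2.2 i c :=
    fun a i b => funext (hN1 a i b)
  have eN2 : ∀ a i j, N2 a i j = fun u : Es m n => -∑ k, Γ k i j u.2.1 * u.2.2 k a :=
    fun a i j => funext (hN2 a i j)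
  intro u f a b r i j c k
  -- the coordinate derivatives of `N1`, `N2`
  have pt1 : ∀ f r a b, pt b (N1 f r a) u = ∑ c, ptm b (χ f a c) u.1 * u.2.2 r c := by
    intro f r a b
    rw [pt, eN1, fderiv_N1 _ (fun c => dχ f a c)]
    simp [ptm]
  have px1 : ∀ f r a j, px j (N1 f r a) u = 0 := by
    intro f r a j
    rw [px, eN1, fderiv_N1 _ (fun c => dχ f a c)]
    simp
  have pp1 : ∀ f r a j b, pp j b (N1 f r a) u = if j = r then χ f a b u.1 else 0 := by
    intro f r a j b
    rw [pp, eN1, fderiv_N1 _ (fun c => dχ f a c)]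
    by_cases hjr : j = r
    · subst hjr
      simp [Pi.single_apply]
    · have : r ≠ j := fun h => hjr h.symm
      simp [Pi.single_apply, hjr, this]
  have pt2 : ∀ f r i b, pt b (N2 f r i) u = 0 := by
    intro f r i b
    rw [pt, eN2, fderiv_N2 _ (fun k => dΓ k r i)]
    simp
  have px2 : ∀ f r i j, px j (N2 f r i) u = -∑ k, ptm j (Γ k r i) u.2.1 * u.2.2 k f := by
    intro f r i j
    rw [px, eN2, fderiv_N2 _ (fun k => dΓ k r i)]
    simp [ptm]
  have pp2 : ∀ f r i j b, pp j b (N2 f r i) u = if b = f then -Γ j r i u.2.1 else 0 := by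
    intro f r i j b
    rw [pp, eN2, fderiv_N2 _ (fun k => dΓ k r i)]
    have : ∀ k, (Pi.single j (Pi.single b (1:ℝ)) : Fin n → Fin m → ℝ) k f =
        if k = j then (if b = f then 1 else 0) else 0 := by
      intro k
      by_cases hk : k = j
      · subst hk
        simp [Pi.single_apply, eq_comm]
      · simp [hk]
    simp only [this]
    by_cases hb : b = f <;> simp [hb]
  -- the adapted derivatives
  have dt1 : ∀ f r a b, dt N1 b (N1 f r a) u =
      ∑ g, (ptm b (χ f a g) u.1 - ∑ e, χ e b g u.1 * χ f a e u.1) * u.2.2 r g := by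
    intro f r a b
    simp only [dt, pt1, pp1, mul_ite, mul_zero, Finset.sum_ite_eq', Finset.mem_univ, if_true,
      hN1, sub_mul, Finset.sum_sub_distrib, Finset.sum_mul]
    rw [Finset.sum_comm]
    congr 1
    refine Finset.sum_congr rfl fun _ _ => Finset.sum_congr rfl fun _ _ => by ring
  have dx2 : ∀ f r i j, dx N2 j (N2 f r i) u =
      -∑ s, (ptm j (Γ s r i) u.2.1 + ∑ e, Γ e r i u.2.1 * Γ s e j u.2.1) * u.2.2 s f := by
    intro f r i j
    simp only [dx, px2, pp2, mul_ite, mul_zero]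
    rw [Finset.sum_comm]
    simp only [Finset.sum_ite_eq', Finset.mem_univ, if_true,
      hN2, add_mul, Finset.sum_add_distrib, Finset.sum_mul, neg_mul_neg]
    rw [Finset.sum_comm, neg_add, sub_eq_add_neg]
    congr 2
    refine Finset.sum_congr rfl fun _ _ => Finset.sum_congr rfl fun _ _ => by ring
  refine ⟨?_, ?_, ?_, ?_, ?_⟩
  · rw [RR1, dt1, dt1, ← Finset.sum_sub_distrib]
    refine Finset.sum_congr rfl fun g _ => ?_
    rw [christoffelCurv, Finset.sum_sub_distrib, ← sub_mul, sχ f a g, sχ f b g]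
    have e1 : ∀ a b, ∑ e, χ e b g u.1 * χ f a e u.1 = ∑ e, χ e g b u.1 * χ f e a u.1 := by
      intro a b
      refine Finset.sum_congr rfl fun e _ => ?_
      rw [sχ e b g, sχ f a e]
    rw [e1, e1]
    ring
  · rw [RRmix, dx, dt]
    simp only [px1, pp1, pt2, pp2, mul_ite, mul_zero, zero_sub]
    rw [Finset.sum_comm (f := fun b_1 j_1 => if b_1 = f then _ else _)]
    simp only [Finset.sum_ite_eq', Finset.mem_univ, if_true, hN1, hN2, neg_mul, mul_neg,
      Finset.sum_neg_distrib, Finset.sum_mul]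
    rw [Finset.sum_comm, neg_neg, neg_neg, sub_eq_zero]
    refine Finset.sum_congr rfl fun _ _ => Finset.sum_congr rfl fun _ _ => by ring
  · rw [RR2, dx2, dx2, neg_sub_neg, ← neg_sub, ← Finset.sum_sub_distrib]
    congr 1
    refine Finset.sum_congr rfl fun g _ => ?_
    rw [christoffelCurv, Finset.sum_sub_distrib]
    ring
  · rw [Ptor1, pp1, sχ f a b]
    by_cases hj : j = r <;> simp [hj, kd]
  · rw [Ptor2, pp2, kd]
    by_cases hb : b = f
    · simp [hb]
    · have hb2 : ¬ f = b := fun h => hb h.symm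
      simp [hb, hb2]
end
end

section
/- For the Berwald connection BΓ(N0) = (χ^a_bc, 0, Γ^i_jk, 0) attached to the canonical nonlinear connection N0 with N1^(a)_(i)b = χ^a_bc p_i^c and N2^(a)_(i)j = −Γ^k_ij p_k^a, all curvature d-tensors vanish except the temporal curvature χ^d_abc = ∂χ^d_ab/∂t^c − ∂χ^d_ac/∂t^b + χ^f_ab χ^d_fc − χ^f_ac χ^d_fb and the spatial curvature R^l_ijk, which equals 𝓡^l_ijk = ∂Γ^l_ij/∂x^k − ∂Γ^l_ik/∂x^j + Γ^r_ij Γ^l_rk − Γ^r_ik Γ^l_rj; in particular R^l_ibc = 0, R^l_ibk := −δΓ^l_ik/δt^b = 0, and the curvature d-tensors P^l(k)_ib(c), P^l(k)_ij(c), S^l(j)(k)_i(b)(c) all vanish. -/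
noncomputable section

variable {m n : ℕ}

theorem christoffel_differentiable {k : ℕ} (g ginv : Fin k → Fin k → (Fin k → ℝ) → ℝ)
    (hg : ∀ a b, ContDiff ℝ (⊤ : ℕ∞) (g a b)) (hi : ∀ a b, ContDiff ℝ (⊤ : ℕ∞) (ginv a b))
    (a b c : Fin k) : Differentiable ℝ (christoffel g ginv a b c) := by
  have h1 : ∀ c a b, Differentiable ℝ (fun t => ptm c (g a b) t) := by
    intro c a b
    have h2 : ContDiff ℝ 1 (fderiv ℝ (g a b)) :=
      ((hg a b).of_le (m := 2) (WithTop.coe_le_coe.2 (le_top : (2 : ℕ∞) ≤ ⊤))).fderiv_right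
        (by norm_num)
    have h3 := h2.differentiable one_ne_zero
    exact h3.clm_apply (differentiable_const _)
  have h4 : ∀ a b, Differentiable ℝ (ginv a b) := fun a b =>
    (hi a b).differentiable (by simp)
  unfold christoffel
  refine Differentiable.const_mul (Differentiable.fun_sum fun d _ => ?_) _
  exact (h4 a d).mul (((h1 c d b).add (h1 b d c)).sub (h1 d b c))

theorem fderiv_lift (f : (Fin n → ℝ) → ℝ) (hf : Differentiable ℝ f) (u v : Es m n) :
    fderiv ℝ (fun w : Es m n => f w.2.1) u v = fderiv ℝ f u.2.1 v.2.1 := by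
  have h1 : HasFDerivAt (fun w : Es m n => w.2.1)
      ((ContinuousLinearMap.fst ℝ (Fin n → ℝ) (Fin n → Fin m → ℝ)).comp
        (ContinuousLinearMap.snd ℝ (Fin m → ℝ) ((Fin n → ℝ) × (Fin n → Fin m → ℝ)))) u :=
    ((ContinuousLinearMap.fst ℝ (Fin n → ℝ) (Fin n → Fin m → ℝ)).comp
        (ContinuousLinearMap.snd ℝ (Fin m → ℝ)
          ((Fin n → ℝ) × (Fin n → Fin m → ℝ)))).hasFDerivAt
  have h2 := (hf u.2.1).hasFDerivAt.comp u h1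
  have h3 := h2.fderiv
  change fderiv ℝ (f ∘ fun w : Es m n => w.2.1) u v = _
  rw [h3]
  rfl

/-- For the Berwald connection `BΓ(N0) = (χ^a_bc, 0, Γ^i_jk, 0)`
attached to the canonical nonlinear connection `N0`, all curvature d-tensors
vanish except the temporal curvature `χ^d_abc` and the spatial curvature
`R^l_ijk`, which equals `𝓡^l_ijk`; in particular `R^l_ibc = 0`,
`R^l_ibk = -δΓ^l_ik/δt^b = 0`, and `P^l(k)_ib(c)`, `P^l(k)_ij(c)`,
`S^l(j)(k)_i(b)(c)` all vanish. -/
theorem berwald_curvature (m n : ℕ) (hm : 1 ≤ m) (hn : 1 ≤ n)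
    -- the temporal metric `h` and its inverse
    (h hinv : Fin m → Fin m → (Fin m → ℝ) → ℝ)
    (hsmooth : ∀ a b, ContDiff ℝ (⊤ : ℕ∞) (h a b)) (hinvsmooth : ∀ a b, ContDiff ℝ (⊤ : ℕ∞) (hinv a b))
    (hsym : ∀ t a b, h a b t = h b a t)
    (hinverse : ∀ t a b, ∑ f, hinv a f t * h f b t = kd a b)
    -- the spatial metric `φ` and its inverse
    (φg φginv : Fin n → Fin n → (Fin n → ℝ) → ℝ)
    (φsmooth : ∀ i j, ContDiff ℝ (⊤ : ℕ∞) (φg i j)) (φinvsmooth : ∀ i j, ContDiff ℝ (⊤ : ℕ∞) (φginv i j))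
    (φsym : ∀ x i j, φg i j x = φg j i x)
    (φinverse : ∀ x i j, ∑ k, φginv i k x * φg k j x = kd i j)
    -- their Christoffel symbols
    (χ : Fin m → Fin m → Fin m → (Fin m → ℝ) → ℝ)
    (Γ : Fin n → Fin n → Fin n → (Fin n → ℝ) → ℝ)
    (hχ : ∀ a b c t, χ a b c t = christoffel h hinv a b c t)
    (hΓ : ∀ i j k x, Γ i j k x = christoffel φg φginv i j k x)
    -- the canonical nonlinear connection `N0`
    (N1 : Fin m → Fin n → Fin m → Es m n → ℝ)
    (N2 : Fin m → Fin n → Fin n → Es m n → ℝ)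
    (hN1 : ∀ a i b (u : Es m n), N1 a i b u = ∑ c, χ a b c u.1 * u.2.2 i c)
    (hN2 : ∀ a i j (u : Es m n), N2 a i j u = -∑ k, Γ k i j u.2.1 * u.2.2 k a)
    -- the Berwald connection components `A^i_jc = 0`, `H^i_jk = Γ^i_jk`, `C^i(k)_j(c) = 0`
    (A : Fin n → Fin n → Fin m → Es m n → ℝ)
    (H : Fin n → Fin n → Fin n → Es m n → ℝ)
    (C : Fin n → Fin n → Fin n → Fin m → Es m n → ℝ)
    (hA : ∀ i j c (u : Es m n), A i j c u = 0)
    (hH : ∀ i j k (u : Es m n), H i j k u = Γ i j k u.2.1)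
    (hC : ∀ i k j c (u : Es m n), C i k j c u = 0) :
    ∀ (u : Es m n) (l i j k : Fin n) (b c : Fin m),
      -- `R^l_ibc = 0`
      curvT N1 A C l i b c u = 0 ∧
      -- `R^l_ibk = -δΓ^l_ik/δt^b = 0`
      curvMix N1 N2 A H C l i b k u = 0 ∧
      curvMix N1 N2 A H C l i b k u =
        -(dt N1 b (fun v => Γ l i k v.2.1) u) ∧
      -- `R^l_ijk = 𝓡^l_ijk`
      curvH N2 H C l i j k u = christoffelCurv Γ l i j k u.2.1 ∧
      -- `P^l(k)_ib(c) = 0`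
      curvP1 N1 χ A C l i b k c u = 0 ∧
      -- `P^l(k)_ij(c) = 0`
      curvP2 N2 H C l i j k c u = 0 ∧
      -- `S^l(j)(k)_i(b)(c) = 0`
      curvS C l j k i b c u = 0 := by
  intro u l i j k b c
  have hA' : ∀ i j c, A i j c = fun _ => 0 := fun i j c => funext (hA i j c)
  have hC' : ∀ i k j c, C i k j c = fun _ => 0 := fun i k j c => funext (hC i k j c)
  have hH' : ∀ i j k, H i j k = fun u => Γ i j k u.2.1 := fun i j k => funext (hH i j k)
  have hd : ∀ i j k, Differentiable ℝ (Γ i j k) := by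
    intro i j k
    rw [show Γ i j k = christoffel φg φginv i j k from funext (hΓ i j k)]
    exact christoffel_differentiable φg φginv φsmooth φinvsmooth i j k
  have hl := fun i j k (u v : Es m n) => fderiv_lift (Γ i j k) (hd i j k) u v
  refine ⟨?_, ?_, ?_, ?_, ?_, ?_, ?_⟩
  · simp [curvT, hA', hC', dt, pt, pp]
  · simp [curvMix, hA', hC', hH', dt, dx, pt, px, pp, hl]
  · simp [curvMix, hA', hC', hH', dt, dx, pt, px, pp, hl]
  · simp [curvH, christoffelCurv, ptm, hC', hH', dx, px, pp, hl]
  · simp [curvP1, CcovT, hA', hC', dt, pt, pp]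
  · simp [curvP2, CcovX, hC', hH', dx, px, pp, hl]
  · simp [curvS, hC', pp]
end
end

section
/- For any smooth function X^a on E* (the temporal components of a d-vector field), the h_T-Ricci identity holds: X^a_{/b/c} − X^a_{/c/b} = X^f χ^a_fbc − (∂X^a/∂p_r^f) R^(f)_(r)bc, where χ^a_fbc = ∂χ^a_fb/∂t^c − ∂χ^a_fc/∂t^b + χ^e_fb χ^a_ec − χ^e_fc χ^a_eb and R^(f)_(r)bc = δN1^(f)_(r)b/δt^c − δN1^(f)_(r)c/δt^b. -/
noncomputable section

variable {m n : ℕ}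

section Ricci9

variable (N1 : Fin m → Fin n → Fin m → Es m n → ℝ)
variable (χ : Fin m → Fin m → Fin m → (Fin m → ℝ) → ℝ)

/-- `T`-horizontal covariant derivative `X^a_{/b} = δX^a/δt^b + X^f χ^a_fb` of the
temporal components of a d-vector field. -/
def covTt (X : Fin m → Es m n → ℝ) (a b : Fin m) (u : Es m n) : ℝ :=
  dt N1 b (X a) u + ∑ f, X f u * χ a f b u.1

/-- Second covariant derivative
`X^a_{/b/c} = δ(X^a_{/b})/δt^c + X^f_{/b} χ^a_fc - X^a_{/f} χ^f_bc`. -/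
def covTt2 (X : Fin m → Es m n → ℝ) (a b c : Fin m) (u : Es m n) : ℝ :=
  dt N1 c (fun v => covTt N1 χ X a b v) u + ∑ f, covTt N1 χ X f b u * χ a f c u.1 -
    ∑ f, covTt N1 χ X a f u * χ f b c u.1

end Ricci9

theorem aux_lin (L : Es m n →L[ℝ] ℝ) (q : Fin n → Fin m → ℝ) :
    L (0, 0, q) = ∑ b, ∑ j, q j b * L (0, 0, Pi.single j (Pi.single b 1)) := by
  have hq : ((0, 0, q) : Es m n) =
      ∑ b, ∑ j, q j b • ((0, 0, Pi.single j (Pi.single b 1)) : Es m n) := by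
    refine Prod.ext ?_ (Prod.ext ?_ ?_)
    · simp [Prod.fst_sum]
    · simp [Prod.fst_sum, Prod.snd_sum]
    · funext j b
      simp only [Prod.snd_sum, Prod.smul_snd, Finset.sum_apply, Pi.smul_apply, smul_eq_mul]
      rw [Finset.sum_eq_single b, Finset.sum_eq_single j]
      · simp
      · intro k _ hk
        simp [Pi.single_eq_of_ne hk.symm]
      · simp
      · intro d _ hd
        refine Finset.sum_eq_zero fun k _ => ?_
        by_cases hk : j = k
        · subst hk
          simp [Pi.single_eq_of_ne hd.symm]
        · simp [Pi.single_eq_of_ne hk]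
      · simp
  rw [hq, map_sum]
  refine Finset.sum_congr rfl fun b _ => ?_
  rw [map_sum]
  refine Finset.sum_congr rfl fun j _ => ?_
  rw [map_smul, smul_eq_mul]

/-- the adapted vector field `δ/δt^a` -/
def VV (N1 : Fin m → Fin n → Fin m → Es m n → ℝ) (a : Fin m) (u : Es m n) : Es m n :=
  (Pi.single a 1, 0, fun j b => - N1 b j a u)

theorem dt_eq (N1 : Fin m → Fin n → Fin m → Es m n → ℝ) (a : Fin m) (F : Es m n → ℝ)
    (u : Es m n) : dt N1 a F u = fderiv ℝ F u (VV N1 a u) := by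
  have h : VV N1 a u = (Pi.single a 1, 0, 0) + (0, 0, fun j b => - N1 b j a u) := by
    simp [VV]
  rw [h, map_add, aux_lin]
  simp [dt, pt, pp, sub_eq_add_neg]

theorem hasFDerivAt_VV (N1 : Fin m → Fin n → Fin m → Es m n → ℝ)
    (hN1 : ∀ e r a, ContDiff ℝ (⊤ : ℕ∞) (N1 e r a)) (a : Fin m) (u : Es m n) :
    HasFDerivAt (VV N1 a) ((0 : Es m n →L[ℝ] (Fin m → ℝ)).prod
      ((0 : Es m n →L[ℝ] (Fin n → ℝ)).prod
        (ContinuousLinearMap.pi fun j => ContinuousLinearMap.pi fun b =>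
          - fderiv ℝ (N1 b j a) u))) u := by
  unfold VV
  refine (hasFDerivAt_const _ _).prodMk ((hasFDerivAt_const _ _).prodMk ?_)
  refine hasFDerivAt_pi.2 fun j => hasFDerivAt_pi.2 fun b => ?_
  exact (((hN1 b j a).differentiable (by simp)) u).hasFDerivAt.neg

theorem hasFDerivAt_dt (N1 : Fin m → Fin n → Fin m → Es m n → ℝ)
    (hN1 : ∀ e r a, ContDiff ℝ (⊤ : ℕ∞) (N1 e r a)) (b : Fin m) (F : Es m n → ℝ)
    (hF : ContDiff ℝ (⊤ : ℕ∞) F) (u : Es m n) :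
    DifferentiableAt ℝ (dt N1 b F) u ∧ ∀ w, fderiv ℝ (dt N1 b F) u w =
      fderiv ℝ (fderiv ℝ F) u w (VV N1 b u)
        - ∑ f, ∑ r, fderiv ℝ (N1 f r b) u w * pp r f F u := by
  have e : dt N1 b F = fun u => fderiv ℝ F u (VV N1 b u) := funext (dt_eq N1 b F)
  have h1 : HasFDerivAt (fderiv ℝ F) (fderiv ℝ (fderiv ℝ F) u) u :=
    (((hF.fderiv_right (m := 1) (by norm_cast)).differentiable (by simp)) u).hasFDerivAt
  have h2 := h1.clm_apply (hasFDerivAt_VV N1 hN1 b u)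
  rw [e]
  refine ⟨h2.differentiableAt, fun w => ?_⟩
  rw [h2.fderiv]
  have h3 := aux_lin (fderiv ℝ F u) (fun j f => - fderiv ℝ (N1 f j b) u w)
  simp only [ContinuousLinearMap.add_apply, ContinuousLinearMap.comp_apply,
    ContinuousLinearMap.flip_apply]
  have h4 : ((0 : Es m n →L[ℝ] (Fin m → ℝ)).prod
      ((0 : Es m n →L[ℝ] (Fin n → ℝ)).prod
        (ContinuousLinearMap.pi fun j => ContinuousLinearMap.pi fun f =>
          - fderiv ℝ (N1 f j b) u))) w = (0, 0, fun j f => - fderiv ℝ (N1 f j b) u w) := rfl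
  rw [h4, h3]
  simp only [pp, neg_mul, Finset.sum_neg_distrib]
  ring

theorem dt_comm (N1 : Fin m → Fin n → Fin m → Es m n → ℝ)
    (hN1 : ∀ e r a, ContDiff ℝ (⊤ : ℕ∞) (N1 e r a)) (b c : Fin m) (F : Es m n → ℝ)
    (hF : ContDiff ℝ (⊤ : ℕ∞) F) (u : Es m n) :
    dt N1 c (dt N1 b F) u - dt N1 b (dt N1 c F) u =
      - ∑ f, ∑ r, pp r f F u * RR1 N1 f r b c u := by
  have hs : fderiv ℝ (fderiv ℝ F) u (VV N1 c u) (VV N1 b u) =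
      fderiv ℝ (fderiv ℝ F) u (VV N1 b u) (VV N1 c u) :=
    (hF.contDiffAt.isSymmSndFDerivAt (by simp; norm_cast)).eq _ _
  rw [dt_eq N1 c, dt_eq N1 b (dt N1 c F), (hasFDerivAt_dt N1 hN1 b F hF u).2,
    (hasFDerivAt_dt N1 hN1 c F hF u).2, hs]
  simp only [RR1, dt_eq, mul_comm (pp _ _ F u), sub_mul, Finset.sum_sub_distrib]
  ring

theorem covTt_dt (N1 : Fin m → Fin n → Fin m → Es m n → ℝ)
    (χ : Fin m → Fin m → Fin m → (Fin m → ℝ) → ℝ)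
    (hχ : ∀ a b c, Differentiable ℝ (χ a b c))
    (hN1 : ∀ e r a, ContDiff ℝ (⊤ : ℕ∞) (N1 e r a))
    (X : Fin m → Es m n → ℝ) (hX : ∀ a, ContDiff ℝ (⊤ : ℕ∞) (X a))
    (u : Es m n) (a b c : Fin m) :
    dt N1 c (fun v => covTt N1 χ X a b v) u = dt N1 c (dt N1 b (X a)) u +
      ∑ f, (X f u * ptm c (χ a f b) u.1 + dt N1 c (X f) u * χ a f b u.1) := by
  have h1 := (hasFDerivAt_dt N1 hN1 b (X a) (hX a) u).1.hasFDerivAt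
  have h2 : ∀ f, HasFDerivAt (fun v : Es m n => χ a f b v.1)
      ((fderiv ℝ (χ a f b) u.1).comp (ContinuousLinearMap.fst ℝ _ _)) u := fun f =>
    ((hχ a f b) u.1).hasFDerivAt.comp u hasFDerivAt_fst
  have h3 : ∀ f, HasFDerivAt (X f) (fderiv ℝ (X f) u) u := fun f =>
    (((hX f).differentiable (by simp)) u).hasFDerivAt
  have h4 := h1.add (HasFDerivAt.fun_sum (u := Finset.univ) fun f _ => (h3 f).mul (h2 f))
  have h5 : HasFDerivAt (fun v => covTt N1 χ X a b v) _ u := h4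
  rw [dt_eq, h5.fderiv, dt_eq N1 c (dt N1 b (X a))]
  simp only [ContinuousLinearMap.add_apply, ContinuousLinearMap.sum_apply,
    ContinuousLinearMap.smul_apply, smul_eq_mul, ContinuousLinearMap.comp_apply, dt_eq N1 c]
  congr 1
  refine Finset.sum_congr rfl fun f _ => ?_
  simp only [ptm]
  have : (ContinuousLinearMap.fst ℝ (Fin m → ℝ) ((Fin n → ℝ) × (Fin n → Fin m → ℝ)))
    (VV N1 c u) = Pi.single c 1 := rfl
  rw [this]
  ring

/-- For any smooth `X^a` on `E*`, the `h_T`-Ricci identity of an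
`h`-normal `N`-linear connection of Cartan type holds:
`X^a_{/b/c} - X^a_{/c/b} = X^f χ^a_fbc - (∂X^a/∂p_r^f) R^(f)_(r)bc`. -/
theorem hT_Ricci_identity (m n : ℕ) (hm : 1 ≤ m) (hn : 1 ≤ n)
    -- the temporal metric `h`, its inverse, and its Christoffel symbols `χ`
    (h hinv : Fin m → Fin m → (Fin m → ℝ) → ℝ)
    (hsmooth : ∀ a b, ContDiff ℝ (⊤ : ℕ∞) (h a b)) (hinvsmooth : ∀ a b, ContDiff ℝ (⊤ : ℕ∞) (hinv a b))
    (hsym : ∀ t a b, h a b t = h b a t)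
    (hinverse : ∀ t a b, ∑ f, hinv a f t * h f b t = kd a b)
    (χ : Fin m → Fin m → Fin m → (Fin m → ℝ) → ℝ)
    (hχ : ∀ a b c t, χ a b c t = christoffel h hinv a b c t)
    -- the nonlinear connection
    (N1 : Fin m → Fin n → Fin m → Es m n → ℝ)
    (N2 : Fin m → Fin n → Fin n → Es m n → ℝ)
    (hN1 : ∀ e r a, ContDiff ℝ (⊤ : ℕ∞) (N1 e r a)) (hN2 : ∀ e r i, ContDiff ℝ (⊤ : ℕ∞) (N2 e r i))
    -- the remaining components of the Cartan-type connection `CDΓ(N)`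
    (A : Fin n → Fin n → Fin m → Es m n → ℝ)
    (H : Fin n → Fin n → Fin n → Es m n → ℝ)
    (C : Fin n → Fin n → Fin n → Fin m → Es m n → ℝ)
    (hAs : ∀ i j c, ContDiff ℝ (⊤ : ℕ∞) (A i j c)) (hHs : ∀ i j k, ContDiff ℝ (⊤ : ℕ∞) (H i j k))
    (hCs : ∀ i k j c, ContDiff ℝ (⊤ : ℕ∞) (C i k j c))
    (hHsym : ∀ i j k (u : Es m n), H i j k u = H i k j u)
    (hCsym : ∀ i k j c (u : Es m n), C i k j c u = C k i j c u)
    -- the temporal components of a d-vector field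
    (X : Fin m → Es m n → ℝ) (hX : ∀ a, ContDiff ℝ (⊤ : ℕ∞) (X a)) :
    ∀ (u : Es m n) (a b c : Fin m),
      covTt2 N1 χ X a b c u - covTt2 N1 χ X a c b u =
        (∑ f, X f u * christoffelCurv χ a f b c u.1) -
          ∑ f, ∑ r, pp r f (X a) u * RR1 N1 f r b c u := by
  intro u a b c
  have hp : ∀ (d : Fin m) (e f : Fin m), Differentiable ℝ (ptm d (h e f)) := fun d e f =>
    (((hsmooth e f).fderiv_right (m := 1) (by norm_cast)).differentiable (by simp)).clm_apply
      (differentiable_const _)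
  have hχe : ∀ a b c, χ a b c = christoffel h hinv a b c := fun a b c => funext (hχ a b c)
  have hχd : ∀ a b c, Differentiable ℝ (χ a b c) := by
    intro a b c
    rw [hχe]
    unfold christoffel
    refine Differentiable.const_mul (Differentiable.fun_sum fun d _ => ?_) _
    exact ((hinvsmooth a d).differentiable (by simp)).mul
      (((hp c d b).add (hp b d c)).sub (hp d b c))
  have hhs : ∀ a b, h a b = h b a := fun a b => funext fun t => hsym t a b
  have hχs : ∀ a b c t, χ a b c t = χ a c b t := by
    intro a b c t
    rw [hχ, hχ]
    unfold christoffel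
    congr 1
    refine Finset.sum_congr rfl fun d _ => ?_
    rw [hhs b c]
    ring
  have hcomm := dt_comm N1 hN1 b c (X a) (hX a) u
  unfold covTt2
  rw [covTt_dt N1 χ hχd hN1 X hX, covTt_dt N1 χ hχd hN1 X hX]
  have h1 : ∑ f, covTt N1 χ X a f u * χ f b c u.1 = ∑ f, covTt N1 χ X a f u * χ f c b u.1 :=
    Finset.sum_congr rfl fun f _ => by rw [hχs f b c]
  have h2 : ∀ b c, ∑ f, covTt N1 χ X f b u * χ a f c u.1 =
      ∑ f, dt N1 b (X f) u * χ a f c u.1 +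
        ∑ f, ∑ e, X f u * (χ e f b u.1 * χ a e c u.1) := by
    intro b c
    rw [Finset.sum_comm, ← Finset.sum_add_distrib]
    refine Finset.sum_congr rfl fun f _ => ?_
    rw [covTt, add_mul, Finset.sum_mul]
    congr 1
    exact Finset.sum_congr rfl fun e _ => by ring
  rw [h1, h2, h2]
  simp only [christoffelCurv, mul_add, mul_sub, Finset.mul_sum, Finset.sum_add_distrib,
    Finset.sum_sub_distrib]
  linarith
end
end

section
/- For an h-normal N-linear connection of Cartan type, the first-set Bianchi identity holds: the cyclic sum over (i,j,k) of { C^l(r)_k(f) R^(f)_(r)ij − R^l_ijk } vanishes, where R^(f)_(r)ij = δN2^(f)_(r)i/δx^j − δN2^(f)_(r)j/δx^i and R^l_ijk = δH^l_ij/δx^k − δH^l_ik/δx^j + H^r_ij H^l_rk − H^r_ik H^l_rj + C^l(r)_i(f) R^(f)_(r)jk. -/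
noncomputable section

variable {m n : ℕ}

/-- For an `h`-normal `N`-linear connection of Cartan type, the
first-set Bianchi identity holds: the cyclic sum over `(i,j,k)` of
`{ C^l(r)_k(f) R^(f)_(r)ij - R^l_ijk }` vanishes. -/
theorem Bianchi_first_set (m n : ℕ) (hm : 1 ≤ m) (hn : 1 ≤ n)
    -- the temporal metric `h`, its inverse, and its Christoffel symbols `χ`
    (h hinv : Fin m → Fin m → (Fin m → ℝ) → ℝ)
    (hsmooth : ∀ a b, ContDiff ℝ (⊤ : ℕ∞) (h a b)) (hinvsmooth : ∀ a b, ContDiff ℝ (⊤ : ℕ∞) (hinv a b))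
    (hsym : ∀ t a b, h a b t = h b a t)
    (hinverse : ∀ t a b, ∑ f, hinv a f t * h f b t = kd a b)
    (χ : Fin m → Fin m → Fin m → (Fin m → ℝ) → ℝ)
    (hχ : ∀ a b c t, χ a b c t = christoffel h hinv a b c t)
    -- the nonlinear connection `N = (N1, N2)`
    (N1 : Fin m → Fin n → Fin m → Es m n → ℝ)
    (N2 : Fin m → Fin n → Fin n → Es m n → ℝ)
    (hN1 : ∀ e r a, ContDiff ℝ (⊤ : ℕ∞) (N1 e r a)) (hN2 : ∀ e r i, ContDiff ℝ (⊤ : ℕ∞) (N2 e r i))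
    -- the remaining components `A^i_jc`, `H^i_jk`, `C^i(k)_j(c)` of the
    -- `h`-normal `N`-linear connection of Cartan type `CDΓ(N)`
    (A : Fin n → Fin n → Fin m → Es m n → ℝ)
    (H : Fin n → Fin n → Fin n → Es m n → ℝ)
    (C : Fin n → Fin n → Fin n → Fin m → Es m n → ℝ)
    (hAs : ∀ i j c, ContDiff ℝ (⊤ : ℕ∞) (A i j c)) (hHs : ∀ i j k, ContDiff ℝ (⊤ : ℕ∞) (H i j k))
    (hCs : ∀ i k j c, ContDiff ℝ (⊤ : ℕ∞) (C i k j c))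
    (hHsym : ∀ i j k (u : Es m n), H i j k u = H i k j u)
    (hCsym : ∀ i k j c (u : Es m n), C i k j c u = C k i j c u)
    : ∀ (u : Es m n) (l i j k : Fin n),
      ((∑ r, ∑ f, C l r k f u * RR2 N2 f r i j u) - curvH N2 H C l i j k u) +
      ((∑ r, ∑ f, C l r i f u * RR2 N2 f r j k u) - curvH N2 H C l j k i u) +
      ((∑ r, ∑ f, C l r j f u * RR2 N2 f r k i u) - curvH N2 H C l k i j u) = 0 := by
  intro u l i j k
  have hf : ∀ a b c, H a b c = H a c b := fun a b c => funext (hHsym a b c)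
  unfold curvH
  simp only [Finset.sum_sub_distrib]
  simp only [hf _ j i, hf _ k j, hf _ i k]
  ring
end
end
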